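/- arXiv:2001.03265 — 2 statements merged into one kernel-verified Lean document; each statement's English description precedes it below -/
import Mathlib

section
/- For every monic polynomial f ∈ F_q[t] and every integer g ≥ 1, one has ∑_{D ∈ H_{2g+1}} χ_D(f) = ∑_{C | f^∞} ∑_{h ∈ M_{2g+1−2d(C)}} χ_f(h) − q · ∑_{C | f^∞} ∑_{h ∈ M_{2g−1−2d(C)}} χ_f(h), where the sums over C run over all monic polynomials C (including C = 1) all of whose irreducible factors divide f, and M_m is empty for m < 0. -/
open Polynomial UniqueFactorizationMonoid
open scoped Classical

noncomputable section

/-- The quadratic residue symbol `(a/P)` for `P` a monic irreducible polynomial: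
`0` if `P ∣ a`, `1` if `a` is a nonzero square mod `P`, `-1` otherwise. -/
def resSym (q : ℕ) (a P : Polynomial (ZMod q)) : ℤ :=
  if P ∣ a then 0 else if ∃ b : Polynomial (ZMod q), P ∣ (a - b ^ 2) then 1 else -1

/-- The symbol `(a/b)`, extended multiplicatively over the monic irreducible factors
of `b` (with multiplicity); by convention `(a/0) = 0`.  In particular `χ_D(f) = (D/f)`
is `jacSym q D f`, and `χ_f(h) = (f/h)` is `jacSym q f h`. -/
def jacSym (q : ℕ) [Fact q.Prime] (a b : Polynomial (ZMod q)) : ℤ :=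
  if b = 0 then 0 else ((normalizedFactors b).map fun P => resSym q a P).prod

/-- The monic polynomial of degree `n` determined by the vector `v` of its
lower-order coefficients. -/
def monicOfDeg (q : ℕ) (n : ℕ) (v : Fin n → ZMod q) : Polynomial (ZMod q) :=
  X ^ n + ∑ i : Fin n, C (v i) * X ^ (i : ℕ)

/-- The polynomial of degree `< n` with coefficient vector `v`. -/
def polyLT (q : ℕ) (n : ℕ) (v : Fin n → ZMod q) : Polynomial (ZMod q) :=
  ∑ i : Fin n, C (v i) * X ^ (i : ℕ)

/-- Sum of `F` over all monic polynomials of degree `m`; empty for `m < 0`. -/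
def sumMonic (q : ℕ) [NeZero q] {M : Type*} [AddCommMonoid M] (m : ℤ)
    (F : Polynomial (ZMod q) → M) : M :=
  if 0 ≤ m then ∑ v : Fin m.toNat → ZMod q, F (monicOfDeg q m.toNat v) else 0

/-- Sum of `F` over all monic polynomials of degree `≤ n`; empty for `n < 0`. -/
def sumMonicLE (q : ℕ) [NeZero q] {M : Type*} [AddCommMonoid M] (n : ℤ)
    (F : Polynomial (ZMod q) → M) : M :=
  if 0 ≤ n then ∑ m ∈ Finset.range (n.toNat + 1), sumMonic q (m : ℤ) F else 0

/-- Sum of `F` over the set `H_{2g+1}` of monic squarefree polynomials of degree `2g+1`. -/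
def sumH (q : ℕ) [NeZero q] {M : Type*} [AddCommMonoid M] (g : ℕ)
    (F : Polynomial (ZMod q) → M) : M :=
  ∑ v : Fin (2 * g + 1) → ZMod q,
    if Squarefree (monicOfDeg q (2 * g + 1) v) then F (monicOfDeg q (2 * g + 1) v) else 0

/-- `e(a/f)` for monic `f`: the additive character `exp(2πi a₁/q)` where `a₁` is the
coefficient of `t⁻¹` in the expansion of `a/f` at infinity, namely the coefficient of
`t^{deg f - 1}` in `a mod f`. -/
def ePoly (q : ℕ) (a f : Polynomial (ZMod q)) : ℂ :=
  Complex.exp (2 * Real.pi * Complex.I *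
    (((a %ₘ f).coeff (f.natDegree - 1)).val : ℂ) / q)

/-- The generalized Gauss sum `G(V, f) = ∑_{u mod f} χ_f(u) e(uV/f)`, the sum running
over the residues `u` modulo `f`, i.e. the polynomials of degree `< deg f`. -/
def gaussS (q : ℕ) [Fact q.Prime] (V f : Polynomial (ZMod q)) : ℂ :=
  ∑ v : Fin f.natDegree → ZMod q,
    (jacSym q f (polyLT q f.natDegree v) : ℂ) * ePoly q (polyLT q f.natDegree v * V) f

/-- The von Mangoldt function: `Λ(f) = deg P` if `f = P^k` with `P` monic irreducible
and `k ≥ 1`, and `0` otherwise. -/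
def vM (q : ℕ) (f : Polynomial (ZMod q)) : ℕ :=
  if h : ∃ P : Polynomial (ZMod q), (∃ k : ℕ, 1 ≤ k ∧ f = P ^ k) ∧ P.Monic ∧ Irreducible P
  then h.choose.natDegree else 0

/-- The monic irreducible polynomials of `F_q[t]`. -/
abbrev MonicIrr (q : ℕ) := {P : Polynomial (ZMod q) // P.Monic ∧ Irreducible P}

/-- `B(α) = ∑_P d(P) / ((|P|^{1+2α} - 1)(|P| + 1))`, over monic irreducible `P`. -/
def Bsum (q : ℕ) (α : ℂ) : ℂ :=
  ∑' P : MonicIrr q, (P.1.natDegree : ℂ) /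
    (((q : ℂ) ^ ((P.1.natDegree : ℂ) * (1 + 2 * α)) - 1) * ((q : ℂ) ^ P.1.natDegree + 1))

end


section Reciprocity

variable {K : Type*} [Field K] [Finite K]

/-- The norm of the class of `a` in `K[X]/(P)` is the resultant of `P` and `a`. -/
theorem resultant_eq_norm {P : K[X]} (hm : P.Monic) (hP : Irreducible P) (a : K[X]) :
    haveI := Fact.mk hP
    resultant P a = Algebra.norm K (AdjoinRoot.mk P a) := by
  have := Fact.mk hP
  have hfin : Module.Finite K (AdjoinRoot P) := hm.finite_adjoinRoot
  let L := AlgebraicClosure K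
  apply (algebraMap K L).injective
  rw [Algebra.norm_eq_prod_embeddings]
  have hs : (P.map (algebraMap K L)).Splits := IsAlgClosed.splits _
  have h1 := resultant_eq_prod_eval (P.map (algebraMap K L)) (a.map (algebraMap K L))
    a.natDegree natDegree_map_le hs
  rw [natDegree_map, resultant_map_map, (hm.map _).leadingCoeff, one_pow, one_mul] at h1
  rw [h1]
  let pb := AdjoinRoot.powerBasis hP.ne_zero
  have hmin : minpoly K pb.gen = P := AdjoinRoot.minpoly_powerBasis_gen_of_monic hm
  have hsep : P.Separable := PerfectField.separable_of_irreducible hP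
  have hnd : (P.aroots L).Nodup := nodup_roots hsep.map
  rw [Fintype.prod_equiv pb.liftEquiv' (fun σ => σ (AdjoinRoot.mk P a))
    (fun x => (a.map (algebraMap K L)).eval x.1) ?_]
  · rw [hmin]
    change ((P.aroots L).map _).prod = _
    rw [Finset.prod_mem_multiset _ _ (fun x => (a.map (algebraMap K L)).eval x) (fun _ => rfl),
      Finset.prod_eq_multiset_prod, Multiset.toFinset_val, Multiset.dedup_eq_self.mpr hnd]
  · intro σ
    rw [PowerBasis.liftEquiv'_apply_coe, AdjoinRoot.powerBasis_gen, eval_map_algebraMap,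
      aeval_algHom_apply, AdjoinRoot.aeval_eq]

theorem quadraticChar_norm {F : Type*} [Field F] [Fintype F] [DecidableEq F] {L : Type*} [Field L]
    [Fintype L] [DecidableEq L] [Algebra F L] (h2 : ringChar F ≠ 2) (x : L) :
    quadraticChar F (Algebra.norm F x) = quadraticChar L x := by
  have hc : ringChar L = ringChar F := (Algebra.ringChar_eq F L).symm
  have h2' : ringChar L ≠ 2 := hc ▸ h2
  have key : ((quadraticChar F (Algebra.norm F x) : ℤ) : L) = (quadraticChar L x : ℤ) := by
    have e := congrArg (algebraMap F L)
      (quadraticChar_eq_pow_of_char_ne_two' h2 (Algebra.norm F x))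
    rw [map_intCast] at e
    rw [e, quadraticChar_eq_pow_of_char_ne_two' h2' x, map_pow,
      FiniteField.algebraMap_norm_eq_pow, ← pow_mul, Nat.card_eq_fintype_card,
      Nat.card_eq_fintype_card]
    congr 1
    have hF := FiniteField.odd_card_of_char_ne_two h2
    have hL := FiniteField.odd_card_of_char_ne_two h2'
    have hF1 : 1 < Fintype.card F := Fintype.one_lt_card
    have hL1 : 1 < Fintype.card L := Fintype.one_lt_card
    have hd : Fintype.card F - 1 ∣ Fintype.card L - 1 := by
      rw [Module.card_eq_pow_finrank (K := F) (V := L)]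
      simpa using Nat.sub_dvd_pow_sub_pow (Fintype.card F) 1 (Module.finrank F L)
    obtain ⟨k, hk⟩ := hd
    rw [hk, Nat.mul_div_cancel_left _ (by omega)]
    obtain ⟨m, hm⟩ : ∃ m, Fintype.card F = 2 * m + 1 := ⟨Fintype.card F / 2, by omega⟩
    obtain ⟨l, hl⟩ : ∃ l, Fintype.card L = 2 * l + 1 := ⟨Fintype.card L / 2, by omega⟩
    have e1 : Fintype.card F / 2 = m := by omega
    have e2 : Fintype.card L / 2 = l := by omega
    rw [e1, e2]
    rw [hm, hl] at hk
    simp only [Nat.add_sub_cancel] at hk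
    nlinarith
  have hne : (1 : L) ≠ -1 := fun h => Ring.neg_one_ne_one_of_char_ne_two h2' h.symm
  rcases quadraticChar_isQuadratic F (Algebra.norm F x) with h | h | h <;>
  rcases quadraticChar_isQuadratic L x with h' | h' | h' <;>
  rw [h, h'] at key ⊢ <;> simp at key <;> first | exact absurd key hne | exact absurd key.symm hne

variable {q : ℕ} [Fact q.Prime]

theorem ringChar_zmod_ne_two (hq : q % 4 = 1) : ringChar (ZMod q) ≠ 2 := by
  rw [ZMod.ringChar_zmod_n]; omega

theorem resSym_eq_quadraticChar_resultant (hq : ringChar (ZMod q) ≠ 2) {P : (ZMod q)[X]}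
    (hm : P.Monic) (hP : Irreducible P) (a : (ZMod q)[X]) :
    resSym q a P = quadraticChar (ZMod q) (resultant P a) := by
  have := Fact.mk hP
  have hfin : Module.Finite (ZMod q) (AdjoinRoot P) := hm.finite_adjoinRoot
  have : Finite (AdjoinRoot P) := Module.finite_of_finite (ZMod q)
  let _ : Fintype (AdjoinRoot P) := Fintype.ofFinite _
  rw [resultant_eq_norm hm hP, quadraticChar_norm hq, resSym]
  split_ifs with h h'
  · rw [AdjoinRoot.mk_eq_zero.2 h, quadraticChar_zero]
  · obtain ⟨b, hb⟩ := h'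
    have hne : AdjoinRoot.mk P a ≠ 0 := fun h0 => h (AdjoinRoot.mk_eq_zero.1 h0)
    refine ((quadraticChar_one_iff_isSquare hne).2 ⟨AdjoinRoot.mk P b, ?_⟩).symm
    rw [← map_mul, AdjoinRoot.mk_eq_mk, ← sq]
    exact hb
  · symm
    rw [quadraticChar_neg_one_iff_not_isSquare]
    rintro ⟨y, hy⟩
    obtain ⟨b, rfl⟩ := AdjoinRoot.mk_surjective y
    refine h' ⟨b, ?_⟩
    rwa [← map_mul, AdjoinRoot.mk_eq_mk, ← sq] at hy

theorem jacSym_eq_quadraticChar_resultant (hq : ringChar (ZMod q) ≠ 2) (a : (ZMod q)[X])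
    {b : (ZMod q)[X]} (hb : b.Monic) :
    jacSym q a b = quadraticChar (ZMod q) (resultant b a) := by
  rw [jacSym, if_neg hb.ne_zero]
  have hprod : (normalizedFactors b).prod = b := by
    rw [prod_normalizedFactors_eq hb.ne_zero, hb.normalize_eq_self]
  conv_rhs => rw [← hprod]
  have hirr : ∀ P ∈ normalizedFactors b, P.Monic ∧ Irreducible P := fun P hP =>
    have hi := irreducible_of_normalized_factor P hP
    ⟨by rw [← normalize_normalized_factor P hP]; exact monic_normalize hi.ne_zero, hi⟩
  generalize normalizedFactors b = s at hirr
  induction s using Multiset.induction_on with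
  | empty => simp
  | cons P s ih =>
    have hP := hirr P (Multiset.mem_cons_self _ _)
    have hs : s.prod.Monic := by
      simpa using monic_multiset_prod_of_monic s id
        fun Q hQ => (hirr Q (Multiset.mem_cons_of_mem hQ)).1
    rw [Multiset.map_cons, Multiset.prod_cons, Multiset.prod_cons, hP.1.natDegree_mul hs,
      resultant_mul_left _ _ _ _ le_rfl, map_mul,
      ih fun Q hQ => hirr Q (Multiset.mem_cons_of_mem hQ),
      resSym_eq_quadraticChar_resultant hq hP.1 hP.2]

/-- Quadratic reciprocity in `F_q[t]` for `q ≡ 1 (mod 4)`. -/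
theorem jacSym_comm (hq : q % 4 = 1) {a b : (ZMod q)[X]} (ha : a.Monic) (hb : b.Monic) :
    jacSym q a b = jacSym q b a := by
  have h2 := ringChar_zmod_ne_two hq
  rw [jacSym_eq_quadraticChar_resultant h2 _ hb, jacSym_eq_quadraticChar_resultant h2 _ ha,
    resultant_comm, map_mul, map_pow]
  have : quadraticChar (ZMod q) (-1) = 1 := by
    rw [quadraticChar_one_iff_isSquare (neg_ne_zero.2 one_ne_zero),
      FiniteField.isSquare_neg_one_iff, ZMod.card]
    omega
  rw [this, one_pow, one_mul]

theorem jacSym_mul_left (hq : ringChar (ZMod q) ≠ 2) {a b f : (ZMod q)[X]}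
    (ha : a ≠ 0) (hb : b ≠ 0) (hf : f.Monic) :
    jacSym q (a * b) f = jacSym q a f * jacSym q b f := by
  simp only [jacSym_eq_quadraticChar_resultant hq _ hf]
  rw [natDegree_mul ha hb, resultant_mul_right _ _ _ _ le_rfl, map_mul]

theorem jacSym_mul_sq_left (hq : ringChar (ZMod q) ≠ 2) {a b f : (ZMod q)[X]}
    (ha : a ≠ 0) (hb : b ≠ 0) (hf : f.Monic) :
    jacSym q (a * b ^ 2) f = if IsCoprime f b then jacSym q a f else 0 := by
  rw [jacSym_mul_left hq ha (pow_ne_zero 2 hb) hf, sq, jacSym_mul_left hq hb hb hf, ← sq,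
    jacSym_eq_quadraticChar_resultant hq b hf, ← isUnit_resultant_iff_isCoprime hf,
    isUnit_iff_ne_zero]
  split_ifs with h
  · rw [quadraticChar_sq_one h, mul_one]
  · rw [not_not.1 h, quadraticChar_zero]; simp

end Reciprocity

section Factorization

variable {K : Type*} [Field K]

theorem Polynomial.Monic.exists_squarefree_mul_sq {B : K[X]} (hB : B.Monic) :
    ∃ D E : K[X], D.Monic ∧ E.Monic ∧ Squarefree D ∧ D * E ^ 2 = B := by
  induction hn : B.natDegree using Nat.strong_induction_on generalizing B with
  | _ n ih =>
    by_cases hs : Squarefree B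
    · exact ⟨B, 1, hB, monic_one, hs, by simp⟩
    · simp only [Squarefree, not_forall] at hs
      obtain ⟨x, hx, hu⟩ := hs
      have hx0 : x ≠ 0 := by
        rintro rfl
        exact hB.ne_zero (by simpa using hx)
      have hy : (normalize x).Monic := monic_normalize hx0
      have hyu : ¬ IsUnit (normalize x) := by rwa [(normalize_associated x).isUnit_iff]
      obtain ⟨B', hB'⟩ : normalize x * normalize x ∣ B :=
        ((normalize_associated x).mul_mul (normalize_associated x)).dvd_iff_dvd_left.2 hx
      have hm : B'.Monic := (hy.mul hy).of_mul_monic_left (hB' ▸ hB)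
      have hpos := hy.natDegree_pos_of_not_isUnit hyu
      have hdeg : B'.natDegree < n := by
        rw [← hn, hB', (hy.mul hy).natDegree_mul hm, hy.natDegree_mul hy]
        omega
      obtain ⟨D, E, hD, hE, hDs, h⟩ := ih _ hdeg hm rfl
      exact ⟨D, E * normalize x, hD, hE.mul hy, hDs, by rw [hB', ← h]; ring⟩

theorem Polynomial.Monic.squarefree_mul_sq_unique {D E D' E' : K[X]} (hD : D.Monic) (hE : E.Monic)
    (hD' : D'.Monic) (hE' : E'.Monic) (hs : Squarefree D) (hs' : Squarefree D')
    (h : D * E ^ 2 = D' * E' ^ 2) : D = D' ∧ E = E' := by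
  have hEE : E = E' := by
    have hf : normalizedFactors E = normalizedFactors E' := by
      rw [squarefree_iff_nodup_normalizedFactors hD.ne_zero, Multiset.nodup_iff_count_le_one] at hs
      rw [squarefree_iff_nodup_normalizedFactors hD'.ne_zero,
        Multiset.nodup_iff_count_le_one] at hs'
      have h2 := congrArg normalizedFactors h
      rw [normalizedFactors_mul hD.ne_zero (pow_ne_zero 2 hE.ne_zero),
        normalizedFactors_mul hD'.ne_zero (pow_ne_zero 2 hE'.ne_zero), normalizedFactors_pow,
        normalizedFactors_pow] at h2
      ext P
      have h3 := congrArg (Multiset.count P) h2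
      simp only [Multiset.count_add, Multiset.count_nsmul] at h3
      have := hs P
      have := hs' P
      omega
    have h4 := congrArg Multiset.prod hf
    rwa [prod_normalizedFactors_eq hE.ne_zero, prod_normalizedFactors_eq hE'.ne_zero,
      hE.normalize_eq_self, hE'.normalize_eq_self] at h4
  subst hEE
  exact ⟨mul_right_cancel₀ (pow_ne_zero 2 hE.ne_zero) h, rfl⟩

theorem Polynomial.Monic.exists_mul_isCoprime {f B : K[X]} (hf : f ≠ 0) (hB : B.Monic) :
    ∃ A E : K[X], A.Monic ∧ E.Monic ∧ (∀ P : K[X], Irreducible P → P ∣ A → P ∣ f) ∧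
      IsCoprime f E ∧ A * E = B := by
  induction hn : B.natDegree using Nat.strong_induction_on generalizing B with
  | _ n ih =>
    by_cases hs : IsCoprime f B
    · exact ⟨1, B, monic_one, hB, fun P hP h => absurd (isUnit_of_dvd_one h) hP.not_isUnit, hs,
        one_mul B⟩
    · obtain ⟨x, hx, hxf, hxB⟩ : ∃ x, Irreducible x ∧ x ∣ f ∧ x ∣ B := by
        by_contra! H
        exact hs (isCoprime_of_irreducible_dvd (fun h => hf h.1) H)
      have hy : (normalize x).Monic := monic_normalize hx.ne_zero
      have hyu : ¬ IsUnit (normalize x) := by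
        rw [(normalize_associated x).isUnit_iff]
        exact hx.not_isUnit
      obtain ⟨B', hB'⟩ := normalize_dvd_iff.2 hxB
      have hm : B'.Monic := hy.of_mul_monic_left (hB' ▸ hB)
      have hpos := hy.natDegree_pos_of_not_isUnit hyu
      have hdeg : B'.natDegree < n := by
        rw [← hn, hB', hy.natDegree_mul hm]
        omega
      obtain ⟨A, E, hA, hE, hAf, hEf, h⟩ := ih _ hdeg hm rfl
      refine ⟨normalize x * A, E, hy.mul hA, hE, fun P hP hd => ?_, hEf, by rw [hB', ← h]; ring⟩
      rcases hP.prime.dvd_or_dvd hd with h' | h'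
      · exact (dvd_normalize_iff.1 h').trans hxf
      · exact hAf P hP h'

theorem Polynomial.Monic.mul_isCoprime_unique {f A E A' E' : K[X]} (hA : A.Monic) (hA' : A'.Monic)
    (hAf : ∀ P : K[X], Irreducible P → P ∣ A → P ∣ f)
    (hAf' : ∀ P : K[X], Irreducible P → P ∣ A' → P ∣ f)
    (hE : IsCoprime f E) (hE' : IsCoprime f E') (h : A * E = A' * E') : A = A' ∧ E = E' := by
  have key : ∀ {A E : K[X]}, A.Monic → (∀ P : K[X], Irreducible P → P ∣ A → P ∣ f) →
      IsCoprime f E → IsCoprime A E := fun hA hAf hE =>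
    isCoprime_of_irreducible_dvd (fun h => hA.ne_zero h.1)
      fun P hP hPA hPE => hP.not_isUnit (hE.isUnit_of_dvd' (hAf P hP hPA) hPE)
  have h1 : A ∣ A' := (key hA hAf hE').dvd_of_dvd_mul_right (h ▸ dvd_mul_right A E)
  have h2 : A' ∣ A := (key hA' hAf' hE).dvd_of_dvd_mul_right (h ▸ dvd_mul_right A' E')
  have hAA : A = A' := eq_of_monic_of_associated hA hA' (associated_of_dvd_dvd h1 h2)
  subst hAA
  exact ⟨rfl, mul_left_cancel₀ hA.ne_zero h⟩

end Factorization

section MonicSums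

open Finset

variable (q : ℕ) [Fact q.Prime]

/-- The finite set of monic polynomials of degree `n`. -/
noncomputable def monics (n : ℕ) : Finset (ZMod q)[X] := univ.image (monicOfDeg q n)

variable {q}

theorem mem_monics {n : ℕ} {B : (ZMod q)[X]} : B ∈ monics q n ↔ B.Monic ∧ B.natDegree = n := by
  simp only [monics, mem_image, mem_univ, true_and]
  constructor
  · rintro ⟨v, rfl⟩
    have h := degree_sum_fin_lt v
    exact ⟨monic_X_pow_add h, (natDegree_add_eq_left_of_degree_lt (h.trans_eq (degree_X_pow n).symm)).trans
      (natDegree_X_pow n)⟩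
  · rintro ⟨hm, rfl⟩
    refine ⟨fun i => B.coeff i, ?_⟩
    conv_rhs => rw [hm.as_sum]
    rw [monicOfDeg, Finset.sum_range]

theorem monicOfDeg_injective (n : ℕ) : Function.Injective (monicOfDeg q n) := by
  intro v w h
  ext i
  have h1 := congrArg (fun p => coeff p (i : ℕ)) (add_left_cancel h)
  simpa [finsetSum_coeff, coeff_C_mul, coeff_X_pow, Fin.val_inj] using h1

theorem sum_monicOfDeg {M : Type*} [AddCommMonoid M] (n : ℕ) (F : (ZMod q)[X] → M) :
    ∑ v : Fin n → ZMod q, F (monicOfDeg q n v) = ∑ B ∈ monics q n, F B := by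
  rw [monics, sum_image fun _ _ _ _ h => monicOfDeg_injective n h]

theorem card_monics (n : ℕ) : #(monics q n) = q ^ n := by
  rw [monics, card_image_of_injective _ (monicOfDeg_injective n)]
  simp

theorem tsum_sumMonic_eq_sum_antidiagonal (p : (ZMod q)[X] → Prop) (F : (ZMod q)[X] → ℂ) (n : ℕ) :
    (∑' A : (ZMod q)[X], if A.Monic ∧ p A then
        sumMonic q (2 * (n : ℤ) + 1 - 2 * A.natDegree) F else 0) =
      ∑ x ∈ antidiagonal n,
        (#{A ∈ monics q x.1 | p A} : ℂ) * ∑ B ∈ monics q (2 * x.2 + 1), F B := by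
  rw [tsum_eq_sum (s := (range (n + 1)).biUnion (monics q)), sum_biUnion,
    Nat.sum_antidiagonal_eq_sum_range_succ_mk]
  · refine sum_congr rfl fun k hk => ?_
    have hk' := mem_range.1 hk
    rw [← nsmul_eq_mul, ← sum_const, sum_filter]
    refine sum_congr rfl fun A hA => ?_
    obtain ⟨hm, rfl⟩ := mem_monics.1 hA
    simp only [hm, true_and]
    have e : 2 * (n : ℤ) + 1 - 2 * A.natDegree = ((2 * (n - A.natDegree) + 1 : ℕ) : ℤ) := by
      omega
    rw [sumMonic, e, if_pos (Int.natCast_nonneg _), Int.toNat_natCast, sum_monicOfDeg]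
  · intro i _ j _ hij
    refine disjoint_left.2 fun A hA hA' => hij ?_
    rw [← (mem_monics.1 hA).2, (mem_monics.1 hA').2]
  · intro A hA
    split_ifs with h
    · have : n < A.natDegree := by
        by_contra! hn
        exact hA (mem_biUnion.2 ⟨_, mem_range.2 (Nat.lt_succ_of_le hn), mem_monics.2 ⟨h.1, rfl⟩⟩)
      rw [sumMonic, if_neg (by omega)]
    · rfl

theorem sum_antidiagonal_card_mul_card_isCoprime {f : (ZMod q)[X]} (hf : f ≠ 0) (n : ℕ) :
    ∑ x ∈ antidiagonal n, #{A ∈ monics q x.1 | ∀ P : (ZMod q)[X], Irreducible P → P ∣ A → P ∣ f} *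
      #{E ∈ monics q x.2 | IsCoprime f E} = q ^ n := by
  rw [← card_monics]
  simp_rw [← card_product]
  rw [← card_sigma]
  refine card_nbij (fun y => y.2.1 * y.2.2) ?_ ?_ ?_
  · rintro ⟨⟨i, j⟩, A, E⟩ h
    simp only [Finset.mem_coe, mem_sigma, HasAntidiagonal.mem_antidiagonal, mem_product, mem_filter, mem_monics] at h
    obtain ⟨hn, ⟨⟨hA, rfl⟩, -⟩, ⟨hE, rfl⟩, -⟩ := h
    exact mem_monics.2 ⟨hA.mul hE, by rw [hA.natDegree_mul hE, hn]⟩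
  · rintro ⟨⟨i, j⟩, A, E⟩ h ⟨⟨i', j'⟩, A', E'⟩ h' heq
    simp only [Finset.mem_coe, mem_sigma, HasAntidiagonal.mem_antidiagonal, mem_product, mem_filter, mem_monics] at h h'
    obtain ⟨-, ⟨⟨hA, rfl⟩, hAf⟩, ⟨hE, rfl⟩, hEf⟩ := h
    obtain ⟨-, ⟨⟨hA', rfl⟩, hAf'⟩, ⟨hE', rfl⟩, hEf'⟩ := h'
    obtain ⟨rfl, rfl⟩ := hA.mul_isCoprime_unique hA' hAf hAf' hEf hEf' heq
    rfl
  · intro B hB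
    obtain ⟨hBm, rfl⟩ := mem_monics.1 (Finset.mem_coe.1 hB)
    obtain ⟨A, E, hA, hE, hAf, hEf, rfl⟩ := hBm.exists_mul_isCoprime hf
    refine ⟨⟨(A.natDegree, E.natDegree), A, E⟩, ?_, rfl⟩
    simp only [Finset.mem_coe, mem_sigma, HasAntidiagonal.mem_antidiagonal, mem_product, mem_filter, mem_monics]
    exact ⟨(hA.natDegree_mul hE).symm, ⟨⟨hA, trivial⟩, hAf⟩, ⟨hE, trivial⟩, hEf⟩

theorem sum_monics_jacSym (hq : ringChar (ZMod q) ≠ 2) {f : (ZMod q)[X]} (hf : f.Monic) (n : ℕ) :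
    ∑ B ∈ monics q (2 * n + 1), jacSym q B f =
      ∑ x ∈ antidiagonal n, #{E ∈ monics q x.1 | IsCoprime f E} *
        ∑ D ∈ monics q (2 * x.2 + 1) with Squarefree D, jacSym q D f := by
  have h1 : ∀ x ∈ antidiagonal n, (#{E ∈ monics q x.1 | IsCoprime f E} : ℤ) *
      (∑ D ∈ monics q (2 * x.2 + 1) with Squarefree D, jacSym q D f) =
      ∑ y ∈ monics q x.1 ×ˢ {D ∈ monics q (2 * x.2 + 1) | Squarefree D},
        jacSym q (y.2 * y.1 ^ 2) f := by
    intro x _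
    rw [← nsmul_eq_mul, ← sum_const, sum_filter, sum_product]
    refine sum_congr rfl fun E hE => ?_
    have hE' := (mem_monics.1 hE).1.ne_zero
    rw [sum_congr rfl fun D hD => jacSym_mul_sq_left hq
      (mem_monics.1 (mem_filter.1 hD).1).1.ne_zero hE' hf]
    split_ifs <;> simp
  rw [sum_congr rfl h1, sum_sigma']
  symm
  refine sum_nbij (fun y => y.2.2 * y.2.1 ^ 2) ?_ ?_ ?_ fun _ _ => rfl
  · rintro ⟨⟨i, j⟩, E, D⟩ h
    simp only [mem_sigma, HasAntidiagonal.mem_antidiagonal, mem_product, mem_filter, mem_monics] at h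
    obtain ⟨hn, ⟨hE, rfl⟩, ⟨hD, hj⟩, -⟩ := h
    refine mem_monics.2 ⟨hD.mul (hE.pow 2), ?_⟩
    rw [hD.natDegree_mul (hE.pow 2), hE.natDegree_pow, hj]
    omega
  · rintro ⟨⟨i, j⟩, E, D⟩ h ⟨⟨i', j'⟩, E', D'⟩ h' heq
    simp only [Finset.mem_coe, mem_sigma, HasAntidiagonal.mem_antidiagonal, mem_product, mem_filter, mem_monics] at h h'
    obtain ⟨-, ⟨hE, rfl⟩, ⟨hD, hj⟩, hDs⟩ := h
    obtain ⟨-, ⟨hE', rfl⟩, ⟨hD', hj'⟩, hDs'⟩ := h'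
    obtain ⟨rfl, rfl⟩ := hD.squarefree_mul_sq_unique hE hD' hE' hDs hDs' heq
    obtain rfl : j = j' := by omega
    rfl
  · intro B hB
    obtain ⟨hBm, hn⟩ := mem_monics.1 (Finset.mem_coe.1 hB)
    obtain ⟨D, E, hD, hE, hDs, rfl⟩ := hBm.exists_squarefree_mul_sq
    rw [hD.natDegree_mul (hE.pow 2), hE.natDegree_pow] at hn
    refine ⟨⟨(E.natDegree, D.natDegree / 2), E, D⟩, ?_, rfl⟩
    simp only [Finset.mem_coe, mem_sigma, HasAntidiagonal.mem_antidiagonal, mem_product, mem_filter, mem_monics]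
    exact ⟨by omega, ⟨hE, trivial⟩, ⟨hD, by omega⟩, hDs⟩

/-- If `c * e` is the geometric series of ratio `r` and `a = e * h`, then
`h = (1 - r X) * c * a` as generating series. -/
theorem coeff_eq_of_convolution {R : Type*} [CommRing R] {r : R} {c e a h : ℕ → R}
    (hce : ∀ n, ∑ x ∈ antidiagonal n, c x.1 * e x.2 = r ^ n)
    (ha : ∀ n, a n = ∑ x ∈ antidiagonal n, e x.1 * h x.2) (n : ℕ) :
    h (n + 1) = ∑ x ∈ antidiagonal (n + 1), c x.1 * a x.2 -
      r * ∑ x ∈ antidiagonal n, c x.1 * a x.2 := by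
  have hce' : PowerSeries.mk c * PowerSeries.mk e = PowerSeries.mk (fun n => r ^ n) := by
    ext n
    simp [PowerSeries.coeff_mul, hce]
  have ha' : PowerSeries.mk a = PowerSeries.mk e * PowerSeries.mk h := by
    ext n
    simp [PowerSeries.coeff_mul, ha]
  have key : ∀ n, ∑ x ∈ antidiagonal n, c x.1 * a x.2 =
      ∑ x ∈ antidiagonal n, r ^ x.1 * h x.2 := by
    intro n
    have := congrArg (PowerSeries.coeff n)
      (show PowerSeries.mk c * PowerSeries.mk a = PowerSeries.mk (fun n => r ^ n) * .mk h by
        rw [ha', ← mul_assoc, hce'])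
    simpa [PowerSeries.coeff_mul] using this
  rw [key, key, Nat.sum_antidiagonal_succ, mul_sum]
  simp [pow_succ', mul_assoc]

end MonicSums

/-- Lemma 2.2 of the paper: for monic `f` and `g ≥ 1`,
`∑_{D ∈ H_{2g+1}} χ_D(f) = ∑_{C | f^∞} ∑_{h ∈ M_{2g+1-2d(C)}} χ_f(h)
  - q ∑_{C | f^∞} ∑_{h ∈ M_{2g-1-2d(C)}} χ_f(h)`. -/
theorem statement0 (q : ℕ) [Fact q.Prime] (hq4 : q % 4 = 1)
    (f : Polynomial (ZMod q)) (hf : f.Monic) (g : ℕ) (hg : 1 ≤ g) :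
    sumH q g (fun D => (jacSym q D f : ℂ))
      = (∑' C : Polynomial (ZMod q),
          if C.Monic ∧ ∀ P : Polynomial (ZMod q), Irreducible P → P ∣ C → P ∣ f then
            sumMonic q (2 * (g : ℤ) + 1 - 2 * C.natDegree) (fun h => (jacSym q f h : ℂ))
          else 0)
        - (q : ℂ) * ∑' C : Polynomial (ZMod q),
            if C.Monic ∧ ∀ P : Polynomial (ZMod q), Irreducible P → P ∣ C → P ∣ f then
              sumMonic q (2 * (g : ℤ) - 1 - 2 * C.natDegree) (fun h => (jacSym q f h : ℂ))
            else 0 := by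
  obtain ⟨n, rfl⟩ := Nat.exists_eq_succ_of_ne_zero (Nat.one_le_iff_ne_zero.1 hg)
  have e : 2 * ((n.succ : ℕ) : ℤ) - 1 = 2 * (n : ℤ) + 1 := by push_cast; ring
  simp only [e]
  rw [tsum_sumMonic_eq_sum_antidiagonal, tsum_sumMonic_eq_sum_antidiagonal, sumH,
    sum_monicOfDeg _ fun D => if Squarefree D then (jacSym q D f : ℂ) else 0, ← Finset.sum_filter]
  refine coeff_eq_of_convolution
    (h := fun k => ∑ D ∈ monics q (2 * k + 1) with Squarefree D, (jacSym q D f : ℂ))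
    (a := fun k => ∑ B ∈ monics q (2 * k + 1), (jacSym q f B : ℂ))
    (c := fun k => ((Finset.card {A ∈ monics q k |
      ∀ P : (ZMod q)[X], Irreducible P → P ∣ A → P ∣ f} : ℕ) : ℂ))
    (e := fun k => ((Finset.card {E ∈ monics q k | IsCoprime f E} : ℕ) : ℂ)) ?_ ?_ n
  · intro k
    exact_mod_cast sum_antidiagonal_card_mul_card_isCoprime hf.ne_zero k
  · intro k
    rw [Finset.sum_congr rfl fun B hB =>
      congrArg (Int.cast (R := ℂ)) (jacSym_comm hq4 hf (mem_monics.1 hB).1)]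
    exact_mod_cast sum_monics_jacSym (ringChar_zmod_ne_two hq4) hf k
end

section
/- (Weil bound) There is an absolute constant C such that for every monic polynomial V ∈ F_q[t] that is not a perfect square and every integer n ≥ 1, | ∑_{P ∈ P_n} χ_V(P) | ≤ C (d(V)/n) q^{n/2}. -/
open Polynomial UniqueFactorizationMonoid
open scoped Classical

section Stepanov

variable {K : Type*} [Field K]

theorem Polynomial.pow_sub_dvd_hasseDeriv (f h : K[X]) (N k : ℕ) :
    f ^ (N - k) ∣ hasseDeriv k (f ^ N * h) := by
  induction N generalizing k with
  | zero => simp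
  | succ N ih =>
    rw [pow_succ', mul_assoc, hasseDeriv_mul]
    refine Finset.dvd_sum fun ij hij => ?_
    rw [Finset.HasAntidiagonal.mem_antidiagonal] at hij
    rcases Nat.eq_zero_or_pos ij.1 with h0 | h0
    · have hk : ij.2 = k := by omega
      rw [h0, hasseDeriv_zero', hk]
      refine (pow_dvd_pow f (by omega : N + 1 - k ≤ N - k + 1)).trans ?_
      rw [pow_succ']
      exact mul_dvd_mul_left _ (ih k)
    · exact dvd_mul_of_dvd_right ((pow_dvd_pow f (by omega)).trans (ih ij.2)) _

theorem LinearMap.exists_eq_mul_of_forall_dvd (g : K[X]) (hg : g ≠ 0) (L : K[X] →ₗ[K] K[X])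
    (h : ∀ p, g ∣ L p) : ∃ T : K[X] →ₗ[K] K[X], ∀ p, L p = g * T p := by
  choose T hT using h
  refine ⟨{ toFun := T, map_add' := fun p r => ?_, map_smul' := fun c p => ?_ }, hT⟩
  · apply mul_left_cancel₀ hg
    rw [mul_add, ← hT, ← hT, ← hT, map_add]
  · apply mul_left_cancel₀ hg
    rw [← hT, map_smul, hT, RingHom.id_apply, mul_smul_comm]

/-- The `k`-th Hasse derivative of `f ^ N * p` is `f ^ (N - k)` times a polynomial which depends
linearly on `p` and has controlled degree. -/
theorem Polynomial.exists_hasseDeriv_pow_mul_eq (f : K[X]) (hf : f ≠ 0) {N k : ℕ} (hk : k ≤ N) :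
    ∃ T : K[X] →ₗ[K] K[X], (∀ p, hasseDeriv k (f ^ N * p) = f ^ (N - k) * T p) ∧
      ∀ p, (T p).natDegree ≤ p.natDegree + k * f.natDegree := by
  obtain ⟨T, hT⟩ := LinearMap.exists_eq_mul_of_forall_dvd (f ^ (N - k)) (pow_ne_zero _ hf)
    ((hasseDeriv k) ∘ₗ (LinearMap.mulLeft K (f ^ N)))
    (fun p => pow_sub_dvd_hasseDeriv f p N k)
  refine ⟨T, hT, fun p => ?_⟩
  by_cases h0 : T p = 0
  · simp [h0]
  have h1 := natDegree_hasseDeriv_le (f ^ N * p) k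
  have h2 : hasseDeriv k (f ^ N * p) = f ^ (N - k) * T p := hT p
  rw [h2, natDegree_mul (pow_ne_zero _ hf) h0, natDegree_pow] at h1
  have h3 := natDegree_mul_le (p := f ^ N) (q := p)
  rw [natDegree_pow] at h3
  obtain ⟨c, rfl⟩ := Nat.exists_eq_add_of_le hk
  rw [Nat.add_sub_cancel_left] at h1
  rw [add_mul] at h3
  omega

theorem Polynomial.isSquare_of_mul_sq_eq_C_mul_sq {f r s : K[X]} (hf : f.Monic) {c : K}
    (h : f * r ^ 2 = C c * s ^ 2) (hr : r ≠ 0) : ∃ b, f = b ^ 2 := by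
  have hc : c ≠ 0 := by
    rintro rfl
    simp [hf.ne_zero, hr] at h
  have hu : C c * C c⁻¹ = (1 : K[X]) := by rw [← C_mul, mul_inv_cancel₀ hc, C_1]
  have hd : r ^ 2 ∣ s ^ 2 := ⟨C c⁻¹ * f, by linear_combination (-C c⁻¹) * h - s ^ 2 * hu⟩
  rw [IsIntegrallyClosed.pow_dvd_pow_iff two_ne_zero] at hd
  obtain ⟨t, rfl⟩ := hd
  have h2 : f = C c * t ^ 2 := by
    apply mul_right_cancel₀ (pow_ne_zero 2 hr)
    rw [h]; ring
  have h3 : c * t.leadingCoeff ^ 2 = 1 := by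
    have := congrArg leadingCoeff h2
    rw [hf.leadingCoeff, leadingCoeff_mul, leadingCoeff_C, leadingCoeff_pow] at this
    exact this.symm
  have h4 : t.leadingCoeff ≠ 0 := by
    intro h0
    simp [h0] at h3
  refine ⟨C (t.leadingCoeff)⁻¹ * t, ?_⟩
  rw [mul_pow, ← C_pow, h2]
  congr 2
  field_simp
  exact h3

theorem Polynomial.mul_card_le_natDegree_of_pow_dvd {R : K[X]} (hR : R ≠ 0) (l : ℕ) (T : Finset K)
    (h : ∀ x ∈ T, (X - C x) ^ l ∣ R) : l * T.card ≤ R.natDegree := by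
  have hd : ∏ x ∈ T, (X - C x) ^ l ∣ R := by
    refine Finset.prod_dvd_of_coprime (fun x _ y _ hxy => ?_) h
    exact (pairwise_coprime_X_sub_C Function.injective_id hxy).pow
  have h1 := natDegree_le_of_dvd hd hR
  rw [natDegree_prod_of_monic _ _ fun x _ => (monic_X_sub_C x).pow l] at h1
  simpa [natDegree_pow, mul_comm] using h1

variable [Fintype K]

theorem FiniteField.eq_zero_of_sum_mul_X_pow_eq_zero (hK : Odd (Fintype.card K)) {f : K[X]}
    (hf : f.Monic) (hsq : ¬ ∃ b, f = b ^ 2) (hf0 : f.coeff 0 ≠ 0) {D : ℕ}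
    (hD : 2 * D + f.natDegree ≤ Fintype.card K + 1) (J : ℕ) (r s : ℕ → K[X])
    (hr : ∀ j, r j ∈ degreeLT K D) (hs : ∀ j, s j ∈ degreeLT K D)
    (h : ∑ j ∈ Finset.range J, (r j + s j * f ^ (Fintype.card K / 2)) *
      (X ^ Fintype.card K) ^ j = 0) :
    ∀ j < J, r j = 0 ∧ s j = 0 := by
  set Q := Fintype.card K with hQ
  have hQ2 : f ^ (Q / 2) * f ^ (Q / 2) * f = expand K Q f := by
    rw [FiniteField.expand_card, ← pow_add, ← pow_succ]
    congr 1
    obtain ⟨k, hk⟩ := hK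
    omega
  have hQ1 : 0 < Q := Fintype.card_pos
  have hexp : X ^ Q ∣ expand K Q f - C (f.coeff 0) := by
    rw [X_pow_dvd_iff]
    intro d hd
    rw [coeff_sub, coeff_expand hQ1, coeff_C]
    rcases Nat.eq_zero_or_pos d with rfl | h0
    · simp
    · rw [if_neg (fun hdv => absurd (Nat.le_of_dvd h0 hdv) (by omega)), if_neg (by omega), sub_zero]
  have key : ∀ r0 s0 : K[X], r0 ∈ degreeLT K D → s0 ∈ degreeLT K D →
      X ^ Q ∣ r0 + s0 * f ^ (Q / 2) → r0 = 0 ∧ s0 = 0 := by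
    intro r0 s0 hr0 hs0 hdv
    have h1 : X ^ Q ∣ f * r0 ^ 2 - C (f.coeff 0) * s0 ^ 2 := by
      have : f * r0 ^ 2 - C (f.coeff 0) * s0 ^ 2 =
          (r0 + s0 * f ^ (Q / 2)) * (f * (r0 - s0 * f ^ (Q / 2))) +
          (expand K Q f - C (f.coeff 0)) * s0 ^ 2 := by
        rw [← hQ2]; ring
      rw [this]
      exact dvd_add (dvd_mul_of_dvd_left hdv _) (dvd_mul_of_dvd_left hexp _)
    have h2 : f * r0 ^ 2 - C (f.coeff 0) * s0 ^ 2 = 0 := by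
      rcases Nat.eq_zero_or_pos D with rfl | hDpos
      · rw [mem_degreeLT] at hr0 hs0
        have e1 : r0 = 0 := by simpa using hr0
        have e2 : s0 = 0 := by simpa using hs0
        simp [e1, e2]
      have hn : ∀ p ∈ degreeLT K D, p.natDegree + 1 ≤ D := by
        intro p hp
        rw [mem_degreeLT] at hp
        by_cases hp0 : p = 0
        · rw [hp0, natDegree_zero]; omega
        · exact (natDegree_lt_iff_degree_lt hp0).2 hp
      have n1 := hn _ hr0
      have n2 := hn _ hs0
      by_contra hne
      have h3 := natDegree_le_of_dvd h1 hne
      rw [natDegree_X_pow] at h3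
      have h4 := natDegree_sub_le (f * r0 ^ 2) (C (f.coeff 0) * s0 ^ 2)
      have h5 : (f * r0 ^ 2).natDegree ≤ f.natDegree + 2 * r0.natDegree :=
        natDegree_mul_le.trans (by gcongr; exact natDegree_pow_le)
      have h6 : (C (f.coeff 0) * s0 ^ 2).natDegree ≤ 2 * s0.natDegree :=
        (natDegree_C_mul_le _ _).trans natDegree_pow_le
      have h7 := max_le (h5.trans (by omega : _ ≤ Q - 1)) (h6.trans (by omega : _ ≤ Q - 1))
      omega
    rw [sub_eq_zero] at h2
    have h3 : r0 = 0 := by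
      by_contra hne
      exact hsq (isSquare_of_mul_sq_eq_C_mul_sq hf h2 hne)
    refine ⟨h3, ?_⟩
    rw [h3] at h2
    simpa [hf0] using h2.symm
  induction J generalizing r s with
  | zero => intro j hj; omega
  | succ J ih =>
    rw [Finset.sum_range_succ', pow_zero, mul_one] at h
    have hS : ∑ j ∈ Finset.range J, (r (j + 1) + s (j + 1) * f ^ (Q / 2)) * (X ^ Q) ^ (j + 1) =
        X ^ Q * ∑ j ∈ Finset.range J, (r (j + 1) + s (j + 1) * f ^ (Q / 2)) * (X ^ Q) ^ j := by
      rw [Finset.mul_sum]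
      refine Finset.sum_congr rfl fun j _ => ?_
      ring
    rw [hS] at h
    have h0 := key (r 0) (s 0) (hr 0) (hs 0)
      ⟨-∑ j ∈ Finset.range J, (r (j + 1) + s (j + 1) * f ^ (Q / 2)) * (X ^ Q) ^ j,
        by linear_combination h⟩
    rw [h0.1, h0.2, zero_mul, add_zero, add_zero] at h
    have h1 := (mul_eq_zero.1 h).resolve_left (pow_ne_zero _ X_ne_zero)
    have h2 := ih (fun j => r (j + 1)) (fun j => s (j + 1)) (fun j => hr _) (fun j => hs _) h1
    intro j hj
    cases j with
    | zero => exact h0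
    | succ j => exact h2 j (by omega)

theorem FiniteField.X_sub_C_pow_dvd_sum_mul_X_pow {l : ℕ} (hl : l ≤ Fintype.card K) (J : ℕ)
    (w : ℕ → K[X]) (x : K)
    (h : ∀ k < l, ∑ j ∈ Finset.range J, (hasseDeriv k (w j)).eval x * x ^ j = 0) :
    (X - C x) ^ l ∣ ∑ j ∈ Finset.range J, w j * (X ^ Fintype.card K) ^ j := by
  rw [X_sub_C_pow_dvd_iff, ← taylor_apply, map_sum]
  have hX : (X + C x) ^ Fintype.card K = X ^ Fintype.card K + C x := by
    rw [← FiniteField.expand_card, map_add, expand_X, expand_C]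
  have hmain : (X : K[X]) ^ l ∣ ∑ j ∈ Finset.range J, taylor x (w j) * C (x ^ j) := by
    rw [X_pow_dvd_iff]
    intro k hk
    rw [finsetSum_coeff, ← h k hk]
    refine Finset.sum_congr rfl fun j _ => ?_
    rw [coeff_mul_C, taylor_coeff]
  have hdiff : (X : K[X]) ^ l ∣ ∑ j ∈ Finset.range J,
      taylor x (w j) * ((X ^ Fintype.card K + C x) ^ j - C x ^ j) := by
    refine Finset.dvd_sum fun j _ => dvd_mul_of_dvd_right ?_ _
    refine dvd_trans ?_ (sub_dvd_pow_sub_pow _ _ j)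
    rw [add_sub_cancel_right]
    exact pow_dvd_pow _ hl
  convert! dvd_add hmain hdiff using 1
  rw [← Finset.sum_add_distrib]
  refine Finset.sum_congr rfl fun j _ => ?_
  rw [taylor_mul, taylor_pow, taylor_X_pow, hX, C_pow]
  ring

/-- Stepanov's auxiliary polynomial: a nonzero polynomial of small degree that vanishes to order
`2 * h` at every `x` with `f(x) ^ (|K| / 2) = a`. -/
theorem FiniteField.exists_stepanov_polynomial (hK : Odd (Fintype.card K)) {f : K[X]}
    (hf : f.Monic) (hsq : ¬ ∃ b, f = b ^ 2) (hf0 : f.coeff 0 ≠ 0) (a : K) {h : ℕ}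
    (hm : 1 ≤ f.natDegree) (hh : f.natDegree + 1 ≤ h) (hQ : 4 * h ^ 2 ≤ Fintype.card K) :
    ∃ R : K[X], R ≠ 0 ∧
      R.natDegree ≤ Fintype.card K * (h + 3 * f.natDegree + 2) + 2 * h * f.natDegree ∧
      ∀ x, f.eval x ^ (Fintype.card K / 2) = a → (X - C x) ^ (2 * h) ∣ R := by
  set Q := Fintype.card K with hQdef
  set m := f.natDegree with hmdef
  obtain ⟨D, hD⟩ : ∃ D, D = (Q - m) / 2 := ⟨_, rfl⟩
  obtain ⟨J, hJ⟩ : ∃ J, J = h + 2 * m + 2 := ⟨_, rfl⟩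
  have hh2 : 2 * h ≤ h ^ 2 := by nlinarith
  have hDh : h ^ 2 + h ≤ D := by omega
  have hDQ : 2 * D + m ≤ Q := by omega
  have h2Q : 2 * h ≤ Q := by omega
  obtain ⟨B, hB⟩ : ∃ B, B = D + 2 * h * m + J := ⟨_, rfl⟩
  have hcount : 2 * h * B < J * (D + D) := by
    obtain ⟨e, he⟩ := Nat.exists_eq_add_of_le hDh
    rw [hB, hJ, he]
    have : 0 < h ^ 2 := pow_pos (by omega) 2
    nlinarith [Nat.zero_le (e * m), Nat.zero_le (h ^ 2 * m)]
  choose T₁ hT₁ hT₁d using fun k : Fin (2 * h) =>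
    exists_hasseDeriv_pow_mul_eq f hf.ne_zero (N := 2 * h) k.2.le
  choose T₂ hT₂ hT₂d using fun k : Fin (2 * h) =>
    exists_hasseDeriv_pow_mul_eq f hf.ne_zero (N := 2 * h + Q / 2)
      (k.2.le.trans (Nat.le_add_right _ _))
  let U := Fin J → degreeLT K D × degreeLT K D
  let rr : ℕ → U →ₗ[K] K[X] := fun j => if hj : j < J then
    (degreeLT K D).subtype ∘ₗ LinearMap.fst K _ _ ∘ₗ LinearMap.proj ⟨j, hj⟩ else 0
  let ss : ℕ → U →ₗ[K] K[X] := fun j => if hj : j < J then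
    (degreeLT K D).subtype ∘ₗ LinearMap.snd K _ _ ∘ₗ LinearMap.proj ⟨j, hj⟩ else 0
  let Ψ : Fin (2 * h) → U →ₗ[K] K[X] := fun k => ∑ j ∈ Finset.range J,
    LinearMap.mulLeft K (X ^ j) ∘ₗ (T₁ k ∘ₗ rr j + a • (T₂ k ∘ₗ ss j))
  let Φ : U →ₗ[K] (Fin (2 * h) → Fin B → K) :=
    LinearMap.pi fun k => LinearMap.pi fun i => lcoeff K i ∘ₗ Ψ k
  have hfin : Module.finrank K (degreeLT K D) = D := by
    rw [(degreeLTEquiv K D).finrank_eq, Module.finrank_fin_fun]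
  have : Module.Finite K (degreeLT K D) := Module.Finite.equiv (degreeLTEquiv K D).symm
  have hker : LinearMap.ker Φ ≠ ⊥ := by
    apply LinearMap.ker_ne_bot_of_finrank_lt
    simp only [U, Module.finrank_pi_fintype, Module.finrank_prod, hfin, Module.finrank_self,
      Finset.sum_const, Finset.card_univ, Fintype.card_fin, smul_eq_mul, mul_one]
    exact hcount
  obtain ⟨u, hu, hu0⟩ := (Submodule.ne_bot_iff _).1 hker
  have hr : ∀ j, rr j u ∈ degreeLT K D := by
    intro j
    by_cases hj : j < J
    · simp [rr, hj]
    · simp [rr, hj]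
  have hs : ∀ j, ss j u ∈ degreeLT K D := by
    intro j
    by_cases hj : j < J
    · simp [ss, hj]
    · simp [ss, hj]
  have hDpos : 0 < D := by nlinarith
  have hnat : ∀ p ∈ degreeLT K D, p.natDegree + 1 ≤ D := by
    intro p hp
    rw [mem_degreeLT] at hp
    by_cases hp0 : p = 0
    · rw [hp0, natDegree_zero]; omega
    · exact (natDegree_lt_iff_degree_lt hp0).2 hp
  have hΨ : ∀ k, Ψ k u = ∑ j ∈ Finset.range J, X ^ j * (T₁ k (rr j u) + C a * T₂ k (ss j u)) := by
    intro k
    simp [Ψ, smul_eq_C_mul]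
  have hΨ0 : ∀ k, Ψ k u = 0 := by
    intro k
    ext i
    rw [coeff_zero]
    by_cases hi : i < B
    · have := congrFun (congrFun (LinearMap.mem_ker.1 hu) k) ⟨i, hi⟩
      simpa [Φ] using this
    · apply coeff_eq_zero_of_natDegree_lt
      have hk := k.2
      have hkm : (k : ℕ) * m ≤ 2 * h * m := Nat.mul_le_mul_right _ hk.le
      have : (Ψ k u).natDegree ≤ B - 1 := by
        rw [hΨ]
        refine natDegree_sum_le_of_forall_le _ _ fun j hj => ?_
        rw [Finset.mem_range] at hj
        have h1 := hT₁d k (rr j u)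
        have h2 := hT₂d k (ss j u)
        rw [← hmdef] at h1 h2
        have h3 := hnat _ (hr j)
        have h4 := hnat _ (hs j)
        have h5 := natDegree_C_mul_le a (T₂ k (ss j u))
        have h6 : (T₁ k (rr j u) + C a * T₂ k (ss j u)).natDegree ≤ D - 1 + 2 * h * m :=
          natDegree_add_le_of_degree_le (by omega) (by omega)
        refine natDegree_mul_le.trans ?_
        rw [natDegree_X_pow]
        omega
      omega
  refine ⟨∑ j ∈ Finset.range J, (f ^ (2 * h) * rr j u + f ^ (2 * h + Q / 2) * ss j u) *
    (X ^ Q) ^ j, ?_, ?_, ?_⟩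
  · intro h0
    have h1 : f ^ (2 * h) * ∑ j ∈ Finset.range J, (rr j u + ss j u * f ^ (Q / 2)) *
        (X ^ Q) ^ j = 0 := by
      rw [← h0, Finset.mul_sum]
      refine Finset.sum_congr rfl fun j _ => ?_
      rw [pow_add]; ring
    have h2 := (mul_eq_zero.1 h1).resolve_left (pow_ne_zero _ hf.ne_zero)
    have h3 := FiniteField.eq_zero_of_sum_mul_X_pow_eq_zero hK hf hsq hf0 (D := D) (by omega) J
      (fun j => rr j u) (fun j => ss j u) hr hs h2
    apply hu0
    funext j
    have h4 := h3 j j.2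
    ext1
    · have h5 : rr j u = (u j).1 := by simp only [rr, dif_pos j.2]; rfl
      exact Subtype.ext (h5.symm.trans h4.1)
    · have h5 : ss j u = (u j).2 := by simp only [ss, dif_pos j.2]; rfl
      exact Subtype.ext (h5.symm.trans h4.2)
  · refine natDegree_sum_le_of_forall_le _ _ fun j hj => ?_
    rw [Finset.mem_range] at hj
    have h3 := hnat _ (hr j)
    have h4 := hnat _ (hs j)
    have h5 : (f ^ (2 * h) * rr j u).natDegree ≤ 2 * h * m + D := by
      refine natDegree_mul_le.trans ?_
      rw [natDegree_pow, ← hmdef]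
      omega
    have h7 : Q / 2 * m ≤ Q * m := Nat.mul_le_mul_right _ (Nat.div_le_self _ _)
    have h6 : (f ^ (2 * h + Q / 2) * ss j u).natDegree ≤ 2 * h * m + Q * m + D := by
      refine natDegree_mul_le.trans ?_
      rw [natDegree_pow, ← hmdef, add_mul]
      omega
    have h8 := natDegree_add_le_of_degree_le (h5.trans (by omega :
      _ ≤ 2 * h * m + Q * m + D)) h6
    refine natDegree_mul_le.trans ?_
    rw [← pow_mul, natDegree_X_pow]
    have h9 : Q * (j + 1) ≤ Q * (h + 2 * m + 2) := Nat.mul_le_mul_left _ (by omega)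
    nlinarith
  · intro x hx
    refine FiniteField.X_sub_C_pow_dvd_sum_mul_X_pow h2Q J _ x fun k hk => ?_
    have h1 : ∀ j, (hasseDeriv k (f ^ (2 * h) * rr j u + f ^ (2 * h + Q / 2) * ss j u)).eval x *
        x ^ j = f.eval x ^ (2 * h - k) *
          (X ^ j * (T₁ ⟨k, hk⟩ (rr j u) + C a * T₂ ⟨k, hk⟩ (ss j u))).eval x := by
      intro j
      have e1 := hT₁ ⟨k, hk⟩ (rr j u)
      have e2 := hT₂ ⟨k, hk⟩ (ss j u)
      have e3 : 2 * h + Q / 2 - k = 2 * h - k + Q / 2 := by omega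
      simp only [] at e1 e2
      rw [map_add, e1, e2, e3, pow_add]
      simp only [eval_add, eval_mul, eval_pow, eval_X, eval_C, hx]
      ring
    rw [Finset.sum_congr rfl fun j _ => h1 j, ← Finset.mul_sum, ← eval_finsetSum, ← hΨ, hΨ0,
      eval_zero, mul_zero]

theorem FiniteField.abs_sum_quadraticChar_le_of_coeff_zero_ne_zero [DecidableEq K]
    (hK : ringChar K ≠ 2) {f : K[X]} (hf : f.Monic) (hsq : ¬ ∃ b, f = b ^ 2)
    (hf0 : f.coeff 0 ≠ 0) :
    |((∑ x : K, quadraticChar K (f.eval x) : ℤ) : ℝ)| ≤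
      23 * f.natDegree * √(Fintype.card K : ℝ) := by
  set Q := Fintype.card K with hQdef
  set m := f.natDegree with hmdef
  set S : ℤ := ∑ x : K, quadraticChar K (f.eval x) with hS
  have hodd : Odd Q := Nat.odd_iff.2 (FiniteField.odd_card_of_char_ne_two hK)
  have hm : 1 ≤ m := by
    by_contra hlt
    have h1 : f = 1 := hf.natDegree_eq_zero.1 (by omega)
    exact hsq ⟨1, by rw [h1, one_pow]⟩
  have hQ1 : 1 ≤ Q := Fintype.card_pos
  have hsum : ∀ e : ℤ, |e| = 1 → e * S ≤
      2 * ((Finset.univ.filter fun x : K => quadraticChar K (f.eval x) = e).card : ℤ) - Q + m := by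
    intro e he
    have h0 : ((Finset.univ.filter fun x : K => f.eval x = 0).card : ℤ) ≤ m := by
      have : (Finset.univ.filter fun x : K => f.eval x = 0) ⊆ f.roots.toFinset := by
        intro x hx
        simpa [hf.ne_zero] using hx
      exact_mod_cast (Finset.card_le_card this).trans
        ((Multiset.toFinset_card_le _).trans (card_roots' f))
    refine le_trans ?_ (add_le_add_right h0 _)
    rw [hS, Finset.mul_sum, Finset.card_filter, Finset.card_filter, hQdef, ← Finset.card_univ,
      Finset.card_eq_sum_ones]
    push_cast
    rw [Finset.mul_sum, ← Finset.sum_sub_distrib, ← Finset.sum_add_distrib]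
    refine Finset.sum_le_sum fun x _ => ?_
    by_cases hx : f.eval x = 0
    · simp only [hx, quadraticChar_zero, mul_zero, if_true]
      split_ifs <;> norm_num
    · rw [if_neg hx]
      rcases quadraticChar_dichotomy hx with h | h <;>
        rcases (abs_eq one_pos.le).1 he with h' | h' <;> rw [h, h'] <;> norm_num
  have hR0 : (0 : ℝ) ≤ √(Q : ℝ) := Real.sqrt_nonneg _
  have hRR : √(Q : ℝ) * √(Q : ℝ) = Q := Real.mul_self_sqrt (Nat.cast_nonneg _)
  have hR1 : (1 : ℝ) ≤ √(Q : ℝ) := Real.one_le_sqrt.2 (by exact_mod_cast hQ1)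
  have hm' : (1 : ℝ) ≤ m := by exact_mod_cast hm
  obtain ⟨h, hh⟩ : ∃ h, h = Nat.sqrt Q / 2 := ⟨_, rfl⟩
  have hs1 : Nat.sqrt Q * Nat.sqrt Q ≤ Q := Nat.sqrt_le Q
  have hs2 : Q < (Nat.sqrt Q + 1) * (Nat.sqrt Q + 1) := Nat.lt_succ_sqrt Q
  have hs3 : √(Q : ℝ) ≤ 2 * h + 2 := by
    rw [Real.sqrt_le_left (by positivity)]
    have : Q ≤ (2 * h + 2) ^ 2 := by
      have : Nat.sqrt Q + 1 ≤ 2 * h + 2 := by omega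
      nlinarith
    exact_mod_cast this
  have habs : ∀ B : ℝ, (∀ e : ℤ, |e| = 1 → ((e * S : ℤ) : ℝ) ≤ B) → |(S : ℝ)| ≤ B := by
    intro B hB
    rw [abs_le']
    constructor
    · simpa using hB 1 (by norm_num)
    · simpa using hB (-1) (by norm_num)
  apply habs
  intro e he
  set N := (Finset.univ.filter fun x : K => quadraticChar K (f.eval x) = e).card with hN
  have hS1 : ((e * S : ℤ) : ℝ) ≤ 2 * N - Q + m := by
    have := hsum e he
    exact_mod_cast this
  rcases lt_or_ge h (m + 1) with hlt | hge
  · have hNQ : (N : ℝ) ≤ Q := by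
      have : N ≤ Q := by
        rw [hN, hQdef, ← Finset.card_univ]
        exact Finset.card_filter_le _ _
      exact_mod_cast this
    have hhm : (h : ℝ) ≤ m := by exact_mod_cast Nat.lt_succ_iff.1 hlt
    nlinarith
  · have hhQ : 4 * h ^ 2 ≤ Q := by
      have : 2 * h ≤ Nat.sqrt Q := by omega
      nlinarith
    obtain ⟨R, hRne, hRdeg, hRdvd⟩ :=
      FiniteField.exists_stepanov_polynomial hodd hf hsq hf0 (e : K) hm hge hhQ
    have hNle : 2 * h * N ≤ Q * (h + 3 * m + 2) + 2 * h * m := by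
      refine le_trans ?_ hRdeg
      refine mul_card_le_natDegree_of_pow_dvd hRne _ _ fun x hx => hRdvd x ?_
      rw [← quadraticChar_eq_pow_of_char_ne_two' hK, (Finset.mem_filter.1 hx).2]
    have hNle' : (2 : ℝ) * h * N ≤ Q * (h + 3 * m + 2) + 2 * h * m := by exact_mod_cast hNle
    have hh2 : (2 : ℝ) ≤ h := by
      have : 2 ≤ h := by omega
      exact_mod_cast this
    have hR4 : √(Q : ℝ) ≤ 4 * h := by linarith
    have e1 : (h : ℝ) * (2 * N - Q + m) ≤ Q * (3 * m + 2) + 3 * h * m := by nlinarith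
    have e2 : (Q : ℝ) * (3 * m + 2) ≤ Q * (5 * m) := by gcongr; linarith
    have e3 : (Q : ℝ) * (5 * m) ≤ h * (20 * m * √(Q : ℝ)) := by
      have h1 : √(Q : ℝ) * (√(Q : ℝ) * m) ≤ 4 * h * (√(Q : ℝ) * m) := by gcongr
      rw [← mul_assoc, hRR] at h1
      linarith
    have e4 : (h : ℝ) * (2 * N - Q + m) ≤ h * (20 * m * √(Q : ℝ) + 3 * m) := by linarith
    have e5 := le_of_mul_le_mul_left e4 (by linarith)
    nlinarith

/-- A form of the Weil bound for quadratic character sums over a finite field. -/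
theorem FiniteField.abs_sum_quadraticChar_le [DecidableEq K]
    (hK : ringChar K ≠ 2) {f : K[X]} (hf : f.Monic) (hsq : ¬ ∃ b, f = b ^ 2) :
    |((∑ x : K, quadraticChar K (f.eval x) : ℤ) : ℝ)| ≤
      23 * f.natDegree * √(Fintype.card K : ℝ) := by
  by_cases hroot : ∃ α : K, f.eval α ≠ 0
  · obtain ⟨α, hα⟩ := hroot
    have h := FiniteField.abs_sum_quadraticChar_le_of_coeff_zero_ne_zero hK (f := taylor α f)
      (by rw [Monic, leadingCoeff_taylor]; exact hf)
      (by
        rintro ⟨b, hb⟩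
        refine hsq ⟨taylor (-α) b, ?_⟩
        rw [← taylor_pow, ← hb, taylor_taylor, neg_add_cancel, taylor_zero])
      (by rwa [taylor_coeff_zero])
    have hsum : ∑ x : K, quadraticChar K ((taylor α f).eval x) =
        ∑ x : K, quadraticChar K (f.eval x) := by
      simp only [taylor_eval]
      exact Equiv.sum_comp (Equiv.addRight α) fun x => quadraticChar K (f.eval x)
    rwa [natDegree_taylor, hsum] at h
  · push Not at hroot
    simp only [hroot, quadraticChar_zero, Finset.sum_const_zero, Int.cast_zero, abs_zero]
    positivity
end Stepanov

section PrimeField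

variable {q : ℕ} [Fact q.Prime]

theorem coeff_monicOfDeg (n : ℕ) (v : Fin n → ZMod q) (i : Fin n) :
    (monicOfDeg q n v).coeff i = v i := by
  rw [monicOfDeg, coeff_add, coeff_X_pow, if_neg i.2.ne, zero_add, finsetSum_coeff]
  simp [coeff_C_mul, coeff_X_pow, Fin.val_inj]

theorem degree_sum_C_mul_X_pow_lt (n : ℕ) (v : Fin n → ZMod q) :
    (∑ i : Fin n, C (v i) * X ^ (i : ℕ)).degree < (n : WithBot ℕ) := by
  refine (degree_sum_le _ _).trans_lt ((Finset.sup_lt_iff (WithBot.bot_lt_coe n)).2 fun i _ => ?_)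
  exact (degree_C_mul_X_pow_le _ _).trans_lt (WithBot.coe_lt_coe.2 i.2)

theorem monic_monicOfDeg (n : ℕ) (v : Fin n → ZMod q) : (monicOfDeg q n v).Monic :=
  monic_X_pow_add (degree_sum_C_mul_X_pow_lt n v)

theorem natDegree_monicOfDeg (n : ℕ) (v : Fin n → ZMod q) :
    (monicOfDeg q n v).natDegree = n := by
  rw [monicOfDeg, natDegree_add_eq_left_of_degree_lt, natDegree_X_pow]
  rw [degree_X_pow]
  exact degree_sum_C_mul_X_pow_lt n v

theorem monicOfDeg_coeff {P : (ZMod q)[X]} (hP : P.Monic) {n : ℕ} (hn : P.natDegree = n) :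
    monicOfDeg q n (fun i => P.coeff i) = P := by
  subst hn
  conv_rhs => rw [hP.as_sum]
  rw [monicOfDeg, Finset.sum_range fun i => C (P.coeff i) * X ^ i]

theorem jacSym_eq_resSym {V P : (ZMod q)[X]} (hP : P.Monic) (hirr : Irreducible P) :
    jacSym q V P = resSym q V P := by
  rw [jacSym, if_neg hP.ne_zero, normalizedFactors_irreducible hirr, hP.normalize_eq_self,
    Multiset.map_singleton, Multiset.prod_singleton]

variable {K : Type*} [Field K] [Algebra (ZMod q) K]

theorem not_exists_map_eq_sq (hq : q ≠ 2) {V : (ZMod q)[X]} (hV : V.Monic)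
    (h : ¬ ∃ B, V = B ^ 2) : ¬ ∃ B, V.map (algebraMap (ZMod q) K) = B ^ 2 := by
  rintro ⟨H, hH⟩
  have : CharP K q := charP_of_injective_algebraMap (algebraMap (ZMod q) K).injective q
  have : NeZero (2 : K) := ⟨by
    have h2 : ringChar K ≠ 2 := by rwa [ringChar.eq K q]
    exact Ring.two_ne_zero h2⟩
  have hlc : H.leadingCoeff ^ 2 = 1 := by
    rw [← leadingCoeff_pow, ← hH]
    exact hV.map _
  set G := C H.leadingCoeff * H with hG
  have hG2 : V.map (algebraMap (ZMod q) K) = G ^ 2 := by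
    rw [hG, mul_pow, ← C_pow, hlc, C_1, one_mul, hH]
  have hGm : G.Monic := by
    rw [Monic, hG, leadingCoeff_mul, leadingCoeff_C, ← sq, hlc]
  have hσ : (G.map (frobenius K q)) ^ 2 = G ^ 2 := by
    rw [← Polynomial.map_pow, ← hG2, Polynomial.map_map]
    congr 1
    exact Subsingleton.elim _ _
  have hfix : G.map (frobenius K q) = G := by
    rcases sq_eq_sq_iff_eq_or_eq_neg.1 hσ with h1 | h1
    · exact h1
    · exfalso
      have h2 := congrArg leadingCoeff h1
      rw [leadingCoeff_neg, hGm.leadingCoeff, (hGm.map _).leadingCoeff, eq_neg_iff_add_eq_zero,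
        one_add_one_eq_two] at h2
      exact two_ne_zero h2
  have hlift : G ∈ lifts (algebraMap (ZMod q) K) := by
    rw [lifts_iff_coeff_lifts]
    intro i
    have h1 : (G.coeff i) ^ q = G.coeff i := by
      conv_rhs => rw [← hfix]
      rw [coeff_map, frobenius_def]
    have h2 : G.coeff i ∈ (⊥ : Subfield K) := (Subfield.mem_bot_iff_pow_eq_self K q).2 h1
    exact (bot_le : (⊥ : Subfield K) ≤ (algebraMap (ZMod q) K).fieldRange) h2
  obtain ⟨B, hB⟩ := (mem_lifts _).1 hlift
  refine h ⟨B, ?_⟩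
  apply map_injective _ (algebraMap (ZMod q) K).injective
  rw [hG2, Polynomial.map_pow, hB]

variable [Fintype K]

theorem quadraticChar_aeval_eq_resSym [DecidableEq K] (V : (ZMod q)[X]) {x : K}
    (hx : (minpoly (ZMod q) x).natDegree = Module.finrank (ZMod q) K) :
    quadraticChar K (aeval x V) = resSym q V (minpoly (ZMod q) x) := by
  have hint : IsIntegral (ZMod q) x := .of_finite _ _
  have hsurj : ∀ y : K, ∃ b : (ZMod q)[X], aeval x b = y := by
    intro y
    have h1 : y ∈ IntermediateField.adjoin (ZMod q) {x} := by
      rw [(Field.primitive_element_iff_minpoly_natDegree_eq (ZMod q) x).2 hx]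
      trivial
    rw [← IntermediateField.mem_toSubalgebra,
      IntermediateField.adjoin_simple_toSubalgebra_of_isAlgebraic hint.isAlgebraic,
      Algebra.adjoin_singleton_eq_range_aeval] at h1
    exact h1
  rw [resSym]
  by_cases h0 : minpoly (ZMod q) x ∣ V
  · rw [if_pos h0, (minpoly.dvd_iff).1 h0, quadraticChar_zero]
  · rw [if_neg h0]
    have h1 : aeval x V ≠ 0 := fun h => h0 (minpoly.dvd_iff.2 h)
    have h2 : IsSquare (aeval x V) ↔ ∃ b, minpoly (ZMod q) x ∣ V - b ^ 2 := by
      constructor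
      · rintro ⟨y, hy⟩
        obtain ⟨b, rfl⟩ := hsurj y
        exact ⟨b, minpoly.dvd_iff.2 (by rw [map_sub, map_pow, hy, sq, sub_self])⟩
      · rintro ⟨b, hb⟩
        refine ⟨aeval x b, ?_⟩
        have := minpoly.dvd_iff.1 hb
        rwa [map_sub, map_pow, sub_eq_zero, sq] at this
    split_ifs with hb
    · exact (quadraticChar_one_iff_isSquare h1).2 (h2.2 hb)
    · exact quadraticChar_neg_one_iff_not_isSquare.2 fun h => hb (h2.1 h)

theorem card_filter_minpoly_eq {P : (ZMod q)[X]} (hP : P.Monic) (hirr : Irreducible P)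
    (hdeg : P.natDegree = Module.finrank (ZMod q) K) :
    (Finset.univ.filter fun x : K => minpoly (ZMod q) x = P).card = P.natDegree := by
  have hroot : ∃ x : K, aeval x P = 0 := by
    have : Fact (Irreducible P) := ⟨hirr⟩
    have hfin : Module.finrank (ZMod q) (AdjoinRoot P) = P.natDegree := by
      rw [(AdjoinRoot.powerBasis hP.ne_zero).finrank, AdjoinRoot.powerBasis_dim]
    have : Module.Finite (ZMod q) (AdjoinRoot P) :=
      Module.Finite.of_basis (AdjoinRoot.powerBasis hP.ne_zero).basis
    have : Finite (AdjoinRoot P) := Module.finite_of_finite (ZMod q)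
    obtain ⟨φ⟩ := FiniteField.nonempty_algHom_of_finrank_dvd (F := ZMod q) (K := AdjoinRoot P)
      (L := K) (by rw [hfin, hdeg])
    refine ⟨φ (AdjoinRoot.root P), ?_⟩
    rw [aeval_algHom_apply, AdjoinRoot.aeval_eq, AdjoinRoot.mk_self, map_zero]
  obtain ⟨x, hx⟩ := hroot
  have hmin := minpoly.eq_of_irreducible_of_monic hirr hx hP
  have hsplit : (P.map (algebraMap (ZMod q) K)).Splits := by
    rw [hmin]
    exact Normal.splits inferInstance x
  have hsep : P.Separable := PerfectField.separable_of_irreducible hirr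
  rw [← card_rootSet_eq_natDegree hsep hsplit, ← Set.toFinset_card]
  congr 1
  ext y
  simp only [Finset.mem_filter, Finset.mem_univ, true_and, Set.mem_toFinset,
    mem_rootSet_of_ne hP.ne_zero]
  constructor
  · rintro rfl
    exact minpoly.aeval _ _
  · intro hy
    exact (minpoly.eq_of_irreducible_of_monic hirr hy hP).symm

theorem sum_quadraticChar_of_minpoly_natDegree_eq [DecidableEq K] (V : (ZMod q)[X]) {n : ℕ}
    (hn : Module.finrank (ZMod q) K = n) :
    ∑ x ∈ Finset.univ.filter (fun x : K => (minpoly (ZMod q) x).natDegree = n),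
      quadraticChar K (aeval x V) =
    n * ∑ v : Fin n → ZMod q,
      if Irreducible (monicOfDeg q n v) then jacSym q V (monicOfDeg q n v) else 0 := by
  rw [← Finset.sum_fiberwise _ (fun x : K => fun i : Fin n => (minpoly (ZMod q) x).coeff i),
    Finset.mul_sum]
  refine Finset.sum_congr rfl fun v _ => ?_
  have hset : (Finset.univ.filter (fun x : K => (minpoly (ZMod q) x).natDegree = n)).filter
      (fun x => (fun i : Fin n => (minpoly (ZMod q) x).coeff i) = v) =
      Finset.univ.filter fun x : K => minpoly (ZMod q) x = monicOfDeg q n v := by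
    ext x
    simp only [Finset.mem_filter, Finset.mem_univ, true_and]
    constructor
    · rintro ⟨h1, rfl⟩
      exact (monicOfDeg_coeff (minpoly.monic (.of_finite _ _)) h1).symm
    · intro h1
      rw [h1]
      exact ⟨natDegree_monicOfDeg n v, funext fun i => coeff_monicOfDeg n v i⟩
  rw [hset]
  split_ifs with hirr
  · have hval : ∀ x ∈ Finset.univ.filter (fun x : K => minpoly (ZMod q) x = monicOfDeg q n v),
        quadraticChar K (aeval x V) = jacSym q V (monicOfDeg q n v) := by
      intro x hx
      have h1 := (Finset.mem_filter.1 hx).2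
      rw [jacSym_eq_resSym (monic_monicOfDeg n v) hirr, ← h1]
      apply quadraticChar_aeval_eq_resSym
      rw [h1, natDegree_monicOfDeg, hn]
    rw [Finset.sum_congr rfl hval, Finset.sum_const,
      card_filter_minpoly_eq (monic_monicOfDeg n v) hirr (by rw [natDegree_monicOfDeg, hn]),
      natDegree_monicOfDeg, nsmul_eq_mul]
  · rw [mul_zero]
    refine Finset.sum_eq_zero fun x hx => ?_
    refine absurd ?_ hirr
    rw [← (Finset.mem_filter.1 hx).2]
    exact minpoly.irreducible (.of_finite _ _)

theorem pow_natDegree_minpoly_eq_self (x : K) :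
    x ^ q ^ (minpoly (ZMod q) x).natDegree = x := by
  have h1 : Nat.card (IntermediateField.adjoin (ZMod q) {x}) =
      q ^ (minpoly (ZMod q) x).natDegree := by
    rw [Module.natCard_eq_pow_finrank (K := ZMod q), Nat.card_zmod,
      IntermediateField.adjoin.finrank (.of_finite _ _)]
  have h2 := FiniteField.pow_card (IntermediateField.AdjoinSimple.gen (ZMod q) x)
  rw [← Nat.card_eq_fintype_card, h1] at h2
  simpa using congrArg (algebraMap (IntermediateField.adjoin (ZMod q) {x}) K) h2

theorem card_filter_minpoly_natDegree_ne_le {n : ℕ} (hn : Module.finrank (ZMod q) K = n)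
    (hn0 : 1 ≤ n) :
    (Finset.univ.filter fun x : K => (minpoly (ZMod q) x).natDegree ≠ n).card ≤
      2 * q ^ (n / 2) := by
  have hq : 2 ≤ q := (Fact.out : q.Prime).two_le
  have hgeom : ∀ k, ∑ d ∈ Finset.range k, q ^ (d + 1) ≤ 2 * q ^ k := by
    intro k
    induction k with
    | zero => simp
    | succ k ih =>
      rw [Finset.sum_range_succ]
      have : 2 * q ^ k ≤ q ^ (k + 1) := by rw [pow_succ']; gcongr
      omega
  have hsub : (Finset.univ.filter fun x : K => (minpoly (ZMod q) x).natDegree ≠ n) ⊆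
      (Finset.range (n / 2)).biUnion
        fun d => (X ^ q ^ (d + 1) - X : K[X]).roots.toFinset := by
    intro x hx
    have h1 := (Finset.mem_filter.1 hx).2
    have h2 : (minpoly (ZMod q) x).natDegree ∣ n := by
      rw [← hn]
      exact minpoly.degree_dvd (.of_finite _ _)
    have h3 : 0 < (minpoly (ZMod q) x).natDegree := minpoly.natDegree_pos (.of_finite _ _)
    obtain ⟨c, hc⟩ := h2
    have h4 : (minpoly (ZMod q) x).natDegree ≤ n / 2 := by
      rw [Nat.le_div_iff_mul_le two_pos, hc]
      gcongr
      rcases c with _ | _ | c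
      · omega
      · omega
      · omega
    rw [Finset.mem_biUnion]
    refine ⟨(minpoly (ZMod q) x).natDegree - 1, Finset.mem_range.2 (by omega), ?_⟩
    rw [Nat.sub_add_cancel h3, Multiset.mem_toFinset, mem_roots
      (FiniteField.X_pow_card_pow_sub_X_ne_zero K h3.ne' (by omega)), IsRoot.def, eval_sub,
      eval_pow, eval_X, pow_natDegree_minpoly_eq_self, sub_self]
  refine (Finset.card_le_card hsub).trans (Finset.card_biUnion_le.trans
    (le_trans (Finset.sum_le_sum fun d _ => ?_) (hgeom _)))
  refine (Multiset.toFinset_card_le _).trans ((card_roots' _).trans ?_)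
  rw [FiniteField.X_pow_card_pow_sub_X_natDegree_eq K (Nat.succ_ne_zero d) (by omega)]

end PrimeField

/-- the Weil bound: there is an absolute constant `C` such that for
every monic `V` which is not a perfect square and every `n ≥ 1`,
`|∑_{P ∈ P_n} χ_V(P)| ≤ C (d(V)/n) q^{n/2}`. -/
theorem statement7 :
    ∃ C : ℝ, 0 < C ∧ ∀ (q : ℕ) [Fact q.Prime], q % 4 = 1 →
      ∀ V : Polynomial (ZMod q), V.Monic → (¬ ∃ B : Polynomial (ZMod q), V = B ^ 2) →
      ∀ n : ℕ, 1 ≤ n →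
        |∑ v : Fin n → ZMod q,
            if Irreducible (monicOfDeg q n v) then (jacSym q V (monicOfDeg q n v) : ℝ) else 0|
          ≤ C * ((V.natDegree : ℝ) / n) * Real.sqrt ((q : ℝ) ^ n) := by
  refine ⟨25, by norm_num, ?_⟩
  intro q _ hq V hV hsq n hn
  have hq2 : q ≠ 2 := by
    rintro rfl
    norm_num at hq
  have hq1 : 1 ≤ q := (Fact.out : q.Prime).one_le
  let K := GaloisField q n
  have hfr : Module.finrank (ZMod q) K = n := GaloisField.finrank q (by omega)
  have : Fintype K := Fintype.ofFinite K
  have hcard : Fintype.card K = q ^ n := by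
    rw [← Nat.card_eq_fintype_card]
    exact GaloisField.card q n (by omega)
  have hchar : ringChar K ≠ 2 := by rwa [ringChar.eq K q]
  have hweil := FiniteField.abs_sum_quadraticChar_le hchar (hV.map (algebraMap (ZMod q) K))
    (not_exists_map_eq_sq hq2 hV hsq)
  rw [natDegree_map, hcard, Nat.cast_pow] at hweil
  simp only [eval_map_algebraMap] at hweil
  rw [← Finset.sum_filter_add_sum_filter_not Finset.univ
    (fun x : K => (minpoly (ZMod q) x).natDegree = n),
    sum_quadraticChar_of_minpoly_natDegree_eq V hfr] at hweil
  have hdV : 1 ≤ V.natDegree := by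
    by_contra hlt
    exact hsq ⟨1, by rw [hV.natDegree_eq_zero.1 (by omega), one_pow]⟩
  set T : ℤ := ∑ x ∈ Finset.univ.filter
    (fun x : K => ¬ (minpoly (ZMod q) x).natDegree = n), quadraticChar K (aeval x V) with hT
  have hTle : |(T : ℝ)| ≤ 2 * √((q : ℝ) ^ n) := by
    have h1 : |T| ≤ 2 * (q : ℤ) ^ (n / 2) := by
      refine (Finset.abs_sum_le_sum_abs _ _).trans ((Finset.sum_le_card_nsmul _ _ 1 ?_).trans ?_)
      · intro x _
        by_cases hx : aeval x V = 0
        · simp [hx]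
        · rcases quadraticChar_dichotomy hx with h | h <;> rw [h] <;> norm_num
      · have := card_filter_minpoly_natDegree_ne_le hfr hn
        rw [nsmul_one]
        exact_mod_cast this
    have h2 : |(T : ℝ)| ≤ 2 * (q : ℝ) ^ (n / 2) := by exact_mod_cast h1
    refine h2.trans ?_
    gcongr
    apply Real.le_sqrt_of_sq_le
    rw [← pow_mul]
    exact pow_le_pow_right₀ (by exact_mod_cast hq1) (by omega)
  set S : ℤ := ∑ v : Fin n → ZMod q,
    if Irreducible (monicOfDeg q n v) then jacSym q V (monicOfDeg q n v) else 0 with hS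
  have hSR : (∑ v : Fin n → ZMod q,
      if Irreducible (monicOfDeg q n v) then (jacSym q V (monicOfDeg q n v) : ℝ) else 0) = S := by
    rw [hS]
    push_cast
    rfl
  rw [hSR]
  have hn' : (0 : ℝ) < n := by exact_mod_cast hn
  have hR : 0 ≤ √((q : ℝ) ^ n) := Real.sqrt_nonneg _
  have hdV' : (1 : ℝ) ≤ V.natDegree := by exact_mod_cast hdV
  push_cast at hweil
  have h3 : n * |(S : ℝ)| ≤ 25 * V.natDegree * √((q : ℝ) ^ n) := by
    have h4 : |(n : ℝ) * S| ≤ |(n : ℝ) * S + T| + |(T : ℝ)| := by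
      simpa using abs_sub ((n : ℝ) * S + T) (T : ℝ)
    rw [abs_mul, abs_of_pos hn'] at h4
    nlinarith
  rw [mul_div_assoc', div_mul_eq_mul_div, le_div_iff₀ hn', mul_comm]
  exact h3
end
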